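/- δ_{3,1} = ζ(4)/8 - (ζ(3)·ln 2)/8 + (ln 2)⁴/24, where δ_{3,1} = ∑_{n>m≥1} (1/2)ⁿ/(n³m). -/

import Mathlib

noncomputable def deltaD (s t : ℕ) : ℝ :=
  ∑' n : ℕ, ∑' m : ℕ,
    if 0 < m ∧ m < n then (1/2 : ℝ) ^ n / ((n : ℝ) ^ s * (m : ℝ) ^ t) else 0

open Filter Topology Set

noncomputable def hh (n : ℕ) : ℝ := ∑ k ∈ Finset.range n, (k:ℝ)⁻¹
noncomputable def PS (c : ℕ → ℝ) (x : ℝ) : ℝ := ∑' n, c n * x ^ n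

lemma hh_succ (n : ℕ) : hh (n+1) = hh n + (n:ℝ)⁻¹ := by simp [hh, Finset.sum_range_succ]
lemma hh_zero : hh 0 = 0 := by simp [hh]
lemma hh_one : hh 1 = 0 := by simp [hh]
lemma hh_nonneg (n : ℕ) : 0 ≤ hh n := by unfold hh; positivity
lemma hh_le (n : ℕ) : hh n ≤ n := by
  induction n with
  | zero => simp [hh]
  | succ n ih =>
    rw [hh_succ]; push_cast
    have := Nat.cast_inv_le_one (α := ℝ) n
    linarith
lemma hh_le_sqrt (n : ℕ) : hh n ≤ 3 * √n := by
  induction n with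
  | zero => simp [hh]
  | succ n ih =>
    rcases Nat.eq_zero_or_pos n with rfl | hn
    · simp [hh]
    rw [hh_succ]; push_cast
    have h1 : (1:ℝ) ≤ n := by exact_mod_cast hn
    set s := √(n:ℝ)
    set t := √((n:ℝ)+1)
    have hs : s^2 = n := Real.sq_sqrt (by positivity)
    have ht : t^2 = n+1 := Real.sq_sqrt (by positivity)
    have hs1 : 1 ≤ s := Real.one_le_sqrt.2 h1
    have ht0 : 0 ≤ t := Real.sqrt_nonneg _
    have hts : t ≤ 2 * s := by nlinarith
    have : (n:ℝ)⁻¹ * n = 1 := inv_mul_cancel₀ (by positivity)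
    have hi : 0 ≤ (n:ℝ)⁻¹ := by positivity
    have hmul : (t - s) * (t+s) = 1 := by nlinarith
    have : (n:ℝ)⁻¹ ≤ 3 * (t - s) := by
      rw [inv_le_iff_one_le_mul₀ (by positivity)]
      have hd : 0 ≤ t - s := by nlinarith
      have : t + s ≤ 3 * n := by nlinarith
      nlinarith
    linarith

lemma summable_h2 : Summable (fun n : ℕ => hh n / (n:ℝ)^2) := by
  have : Summable (fun n : ℕ => 3 * (1 / (n:ℝ)^(3/2:ℝ))) :=
    (Real.summable_one_div_nat_rpow.2 (by norm_num)).mul_left 3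
  refine Summable.of_nonneg_of_le (fun n => div_nonneg (hh_nonneg n) (by positivity)) (fun n => ?_) this
  rcases Nat.eq_zero_or_pos n with rfl | hn
  · simp [hh]
  have h1 : (0:ℝ) < n := by exact_mod_cast hn
  rw [div_le_iff₀ (by positivity)]
  refine (hh_le_sqrt n).trans (le_of_eq ?_)
  rw [Real.sqrt_eq_rpow, ← Real.rpow_natCast (n:ℝ) 2, mul_assoc, one_div ((n:ℝ)^_), ← Real.rpow_neg h1.le, ← Real.rpow_add h1]
  norm_num

lemma summable_h3 : Summable (fun n : ℕ => hh n / (n:ℝ)^3) := by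
  refine Summable.of_nonneg_of_le (fun n => div_nonneg (hh_nonneg n) (by positivity)) (fun n => ?_) summable_h2
  rcases Nat.eq_zero_or_pos n with rfl | hn
  · simp [hh]
  have h1 : (1:ℝ) ≤ n := by exact_mod_cast hn
  have := hh_nonneg n
  gcongr; norm_num

lemma PS_cont {c : ℕ → ℝ} (hc : Summable (fun n => |c n|)) : ContinuousOn (PS c) (Icc (-1) 1) := by
  unfold PS
  refine continuousOn_tsum (fun n => by fun_prop) hc (fun n x hx => ?_)
  rw [Real.norm_eq_abs, abs_mul, abs_pow]
  exact mul_le_of_le_one_right (abs_nonneg _) (pow_le_one₀ (abs_nonneg _) (abs_le.2 hx))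

lemma summable_nr {r : ℝ} (h0 : 0 ≤ r) (hr : r < 1) : Summable (fun n : ℕ => (n:ℝ) * r ^ n) := by
  simpa using summable_pow_mul_geometric_of_norm_lt_one 1 (r := r) (by rwa [Real.norm_of_nonneg h0])

lemma PS_summable {c : ℕ → ℝ} (hc : ∀ n, |c n| ≤ n) {x : ℝ} (hx : |x| < 1) :
    Summable (fun n => c n * x ^ n) := by
  refine Summable.of_norm_bounded (summable_nr (abs_nonneg x) hx) (fun n => ?_)
  rw [Real.norm_eq_abs, abs_mul, abs_pow]
  gcongr; exact hc n

lemma PS_deriv0 {c : ℕ → ℝ} (hc : ∀ n, |c n| ≤ n) {x : ℝ} (hx : |x| < 1) :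
    HasDerivAt (PS (fun n => c n / n)) (∑' n, c (n+1) * x ^ n) x := by
  obtain ⟨r, hxr, hr⟩ := exists_between hx
  have hr0 : 0 ≤ r := (abs_nonneg x).trans hxr.le
  have hu : Summable (fun n : ℕ => (n:ℝ) * r ^ (n-1)) := by
    rw [← summable_nat_add_iff 1]
    have := (summable_nr hr0 hr).add (summable_geometric_of_lt_one hr0 hr)
    refine this.congr fun n => ?_
    simp; ring
  have key := hasDerivAt_tsum_of_isPreconnected (𝕜 := ℝ) (F := ℝ) (u := fun n : ℕ => (n:ℝ) * r ^ (n-1))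
    (g := fun n y => c n / n * y ^ n) (g' := fun n y => c n / n * (n * y^(n-1))) (t := Ioo (-r) r) (y₀ := 0) (y := x)
    hu isOpen_Ioo isPreconnected_Ioo (fun n y _ => (hasDerivAt_pow n y).const_mul _) ?_ ?_ ?_ (abs_lt.1 hxr)
  · have e : (∑' n, c (n+1) * x ^ n) = ∑' n, c n / n * (n * x^(n-1)) := by
      rw [tsum_eq_zero_add' (f := fun n => c n / n * (n * x^(n-1)))]
      · simp
        refine tsum_congr fun n => ?_
        have : (n:ℝ)+1 ≠ 0 := by positivity
        field_simp
      · rw [summable_nat_add_iff 1 (f := fun n => c n / n * (n * x^(n-1)))]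
        refine Summable.of_norm_bounded hu (fun n => ?_)
        rcases Nat.eq_zero_or_pos n with rfl | hn
        · simp
        have : (n:ℝ) ≠ 0 := by positivity
        rw [show c n / n * (n * x^(n-1)) = c n * x^(n-1) by field_simp]
        rw [Real.norm_eq_abs, abs_mul, abs_pow]
        gcongr; exact hc n
    rw [e]; exact key
  · intro n y hy
    rcases Nat.eq_zero_or_pos n with rfl | hn
    · simp
    have : (n:ℝ) ≠ 0 := by positivity
    rw [show c n / n * (n * y^(n-1)) = c n * y^(n-1) by field_simp]
    rw [Real.norm_eq_abs, abs_mul, abs_pow]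
    have := (abs_lt.2 hy).le
    gcongr; exact hc n
  · exact ⟨by linarith [abs_nonneg x], by linarith [abs_nonneg x]⟩
  · refine summable_of_ne_finset_zero (s := {0}) fun n hn => ?_
    have : n ≠ 0 := by simpa using hn
    simp [this]

lemma PS_shift {c : ℕ → ℝ} (hc : ∀ n, |c n| ≤ n) {x : ℝ} (hx : |x| < 1) :
    PS c x = x * ∑' n, c (n+1) * x ^ n := by
  have h0 : c 0 = 0 := by simpa using hc 0
  unfold PS
  rw [(PS_summable hc hx).tsum_eq_zero_add, h0, ← tsum_mul_left]
  simp
  exact tsum_congr fun n => by ring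

lemma PS_deriv {c : ℕ → ℝ} (hc : ∀ n, |c n| ≤ n) {x : ℝ} (hx : |x| < 1) (h0 : x ≠ 0) :
    HasDerivAt (PS (fun n => c n / n)) (PS c x / x) x := by
  have := PS_deriv0 hc hx
  rwa [PS_shift hc hx, mul_div_cancel_left₀ _ h0]

noncomputable def Li (s : ℕ) : ℝ → ℝ := PS (fun n => 1 / (n:ℝ)^s)
noncomputable def Sh (s : ℕ) : ℝ → ℝ := PS (fun n => hh n / (n:ℝ)^s)

lemma Li_coef (s : ℕ) (hs : 1 ≤ s) (n : ℕ) : |1 / (n:ℝ)^s| ≤ n := by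
  rcases Nat.eq_zero_or_pos n with rfl | hn
  · simp [zero_pow (by omega : s ≠ 0)]
  have h1 : (1:ℝ) ≤ n := by exact_mod_cast hn
  rw [abs_of_nonneg (by positivity), div_le_iff₀ (by positivity)]
  nlinarith [one_le_pow₀ h1 (n := s)]
lemma Sh_coef (s : ℕ) (n : ℕ) : |hh n / (n:ℝ)^s| ≤ n := by
  rcases Nat.eq_zero_or_pos n with rfl | hn
  · simp [hh]
  have h1 : (1:ℝ) ≤ n := by exact_mod_cast hn
  rw [abs_of_nonneg (div_nonneg (hh_nonneg n) (by positivity)), div_le_iff₀ (by positivity)]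
  nlinarith [one_le_pow₀ h1 (n := s), hh_le n]

lemma Li_succ (s : ℕ) : Li (s+1) = PS (fun n => 1 / (n:ℝ)^s / n) := by
  unfold Li; congr 1; ext n; rw [div_div, pow_succ]
lemma Sh_succ (s : ℕ) : Sh (s+1) = PS (fun n => hh n / (n:ℝ)^s / n) := by
  unfold Sh; congr 1; ext n; rw [div_div, pow_succ]

lemma Li_one {x : ℝ} (hx : |x| < 1) : Li 1 x = - Real.log (1-x) := by
  rw [Li_succ, ← (Real.hasSum_pow_div_log_of_abs_lt_one hx).tsum_eq, PS,
    Summable.tsum_eq_zero_add]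
  · simp; exact tsum_congr fun n => by ring
  · exact (PS_summable (Li_coef 1 le_rfl) hx).congr fun n => by simp

lemma Li_deriv (s : ℕ) (hs : 1 ≤ s) {x : ℝ} (hx : |x| < 1) (h0 : x ≠ 0) :
    HasDerivAt (Li (s+1)) (Li s x / x) x := by
  rw [Li_succ]; exact PS_deriv (Li_coef s hs) hx h0
lemma Sh_deriv (s : ℕ) {x : ℝ} (hx : |x| < 1) (h0 : x ≠ 0) :
    HasDerivAt (Sh (s+1)) (Sh s x / x) x := by
  rw [Sh_succ]; exact PS_deriv (Sh_coef s) hx h0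
lemma Li_diff0 (s : ℕ) (hs : 1 ≤ s) : DifferentiableAt ℝ (Li (s+1)) 0 := by
  rw [Li_succ]; exact (PS_deriv0 (Li_coef s hs) (by simp)).differentiableAt
lemma Sh_diff0 (s : ℕ) : DifferentiableAt ℝ (Sh (s+1)) 0 := by
  rw [Sh_succ]; exact (PS_deriv0 (Sh_coef s) (by simp)).differentiableAt

lemma Li_z (s : ℕ) (hs : 1 ≤ s) : Li s 0 = 0 := by
  rw [Li, PS_shift (Li_coef s hs) (by simp), zero_mul]
lemma Sh_z (s : ℕ) : Sh s 0 = 0 := by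
  rw [Sh, PS_shift (Sh_coef s) (by simp), zero_mul]

lemma Sh_one {x : ℝ} (hx : |x| < 1) : Sh 1 x = Real.log (1-x)^2 / 2 := by
  have hd : ∀ y ∈ Ioo (-1:ℝ) 1, HasDerivAt (fun y => Sh 1 y - Real.log (1-y)^2 / 2) 0 y := by
    intro y hy
    have hy' : |y| < 1 := abs_lt.2 hy
    have hne : 1 - y ≠ 0 := by linarith [hy.2]
    have h1 := PS_deriv0 (Sh_coef 0) hy'
    rw [← Sh_succ 0] at h1
    have hl : HasDerivAt (fun y => Real.log (1-y)^2 / 2) (-Real.log (1-y) / (1-y)) y := by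
      have := (((hasDerivAt_id y).const_sub 1).log hne).pow 2
      refine (this.div_const 2).congr_deriv ?_
      simp; ring
    have hs : Summable (fun n => hh (n+1) / ((n+1:ℕ):ℝ)^0 * y^n) := by
      refine Summable.of_norm_bounded ((summable_nr (abs_nonneg y) hy').add
        (summable_geometric_of_lt_one (abs_nonneg y) hy')) (fun n => ?_)
      rw [Real.norm_eq_abs, abs_mul, abs_pow]
      have := Sh_coef 0 (n+1)
      push_cast at this ⊢
      calc _ ≤ ((n:ℝ)+1) * |y|^n := by gcongr
        _ = _ := by ring
    have e : (∑' n, hh (n+1) / ((n+1:ℕ):ℝ)^0 * y^n) = -Real.log (1-y) / (1-y) := by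
      have e1 : (∑' n, hh (n+1) / ((n+1:ℕ):ℝ)^0 * y^n) = Sh 0 y + Li 1 y := by
        unfold Sh Li PS
        rw [← (PS_summable (Sh_coef 0) hy').tsum_add (PS_summable (Li_coef 1 le_rfl) hy')]
        exact tsum_congr fun n => by simp [hh_succ]; ring
      have e2 := PS_shift (Sh_coef 0) hy'
      rw [← Sh] at e2
      rw [eq_div_iff hne]
      rw [Li_one hy'] at e1
      linear_combination e1 + e2
    rw [e] at h1
    exact (h1.sub hl).congr_deriv (by ring)
  have := isOpen_Ioo.is_const_of_deriv_eq_zero isPreconnected_Ioo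
    (fun y hy => (hd y hy).differentiableAt.differentiableWithinAt) (fun y hy => (hd y hy).deriv)
    (abs_lt.1 hx) (show (0:ℝ) ∈ Ioo (-1:ℝ) 1 by norm_num)
  simp [Sh_z] at this
  linarith

lemma Li_cont (s : ℕ) (hs : 2 ≤ s) : ContinuousOn (Li s) (Icc (-1) 1) := by
  refine PS_cont ?_
  refine (Real.summable_one_div_nat_pow.2 (by omega : 1 < s)).congr fun n => ?_
  rw [abs_of_nonneg (by positivity)]
lemma Sh2_cont : ContinuousOn (Sh 2) (Icc (-1) 1) :=
  PS_cont (summable_h2.congr fun n => (abs_of_nonneg (div_nonneg (hh_nonneg n) (by positivity))).symm)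
lemma Sh3_cont : ContinuousOn (Sh 3) (Icc (-1) 1) :=
  PS_cont (summable_h3.congr fun n => (abs_of_nonneg (div_nonneg (hh_nonneg n) (by positivity))).symm)

lemma const_left {f : ℝ → ℝ} {a b l : ℝ} (hd : ∀ x ∈ Ioo a b, HasDerivAt f 0 x)
    (hl : Tendsto f (𝓝[>] a) (𝓝 l)) {x : ℝ} (hx : x ∈ Ioo a b) : f x = l := by
  refine tendsto_nhds_unique (tendsto_const_nhds.congr' ?_) hl
  filter_upwards [Ioo_mem_nhdsGT (hx.1.trans hx.2)] with y hy
  exact isOpen_Ioo.is_const_of_deriv_eq_zero isPreconnected_Ioo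
    (fun y hy => (hd y hy).differentiableAt.differentiableWithinAt) (fun y hy => (hd y hy).deriv) hx hy

lemma const_both {f : ℝ → ℝ} {a b l m : ℝ} (hab : a < b) (hd : ∀ x ∈ Ioo a b, HasDerivAt f 0 x)
    (hl : Tendsto f (𝓝[>] a) (𝓝 l)) (hm : Tendsto f (𝓝[<] b) (𝓝 m)) : l = m := by
  refine tendsto_nhds_unique (tendsto_const_nhds.congr' ?_) hm
  filter_upwards [Ioo_mem_nhdsLT hab] with y hy
  exact (const_left hd hl hy).symm

lemma log_pow_mul (k : ℕ) {f : ℝ → ℝ} (hf : DifferentiableAt ℝ f 0) (h0 : f 0 = 0) :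
    Tendsto (fun x => Real.log x ^ k * f x) (𝓝[>] 0) (𝓝 0) := by
  have h1 : Tendsto (fun x:ℝ => Real.log x ^ k * x) (𝓝[>] 0) (𝓝 0) := by
    have := (Real.isLittleO_pow_log_id_atTop (n := k)).tendsto_div_nhds_zero
    have h2 := (this.comp tendsto_inv_nhdsGT_zero).const_mul ((-1:ℝ)^k)
    rw [mul_zero] at h2
    refine h2.congr fun x => ?_
    simp [Real.log_inv, neg_pow (Real.log x) k]
    rw [← mul_assoc, ← mul_assoc, ← mul_pow]; simp
  have h2 : f =O[𝓝[>] 0] (fun x => x) := by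
    have := hf.hasDerivAt.isBigO_sub
    simp [h0] at this
    exact this.mono nhdsWithin_le_nhds
  have := ((Asymptotics.isBigO_refl (fun x => Real.log x ^ k) (𝓝[>] 0)).mul h2).trans_tendsto h1
  exact this
lemma inner_tsum_hh (n : ℕ) (c : ℝ) :
    (∑' m : ℕ, if 0 < m ∧ m < n then c / (m:ℝ) else 0) = c * hh n := by
  rw [tsum_eq_sum (s := Finset.range n), hh, Finset.mul_sum]
  · refine Finset.sum_congr rfl fun m hm => ?_
    rw [Finset.mem_range] at hm
    rcases Nat.eq_zero_or_pos m with rfl | h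
    · simp
    · rw [if_pos ⟨h, hm⟩, div_eq_mul_inv]
  · intro m hm
    rw [Finset.mem_range] at hm
    rw [if_neg (by tauto)]

lemma deltaD_eq : deltaD 3 1 = Sh 3 (1/2) := by
  unfold deltaD Sh PS
  refine tsum_congr fun n => ?_
  rw [show hh n / (n:ℝ)^3 * (1/2)^n = ((1/2)^n / (n:ℝ)^3) * hh n by ring, ← inner_tsum_hh]
  refine tsum_congr fun m => ?_
  rw [pow_one, div_div]

noncomputable def FF (p : ℕ × ℕ) : ℝ := 1 / (((p.1:ℝ)+1)^2 * ((p.2:ℝ)+1)^2)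
noncomputable def F22 (p : ℕ × ℕ) : ℝ := 1 / (((p.1:ℝ)+1)^2 * ((p.1:ℝ)+p.2+2)^2)
noncomputable def F31 (p : ℕ × ℕ) : ℝ := 1 / (((p.1:ℝ)+1) * ((p.1:ℝ)+p.2+2)^3)

lemma FF_summable : Summable FF := by
  have h : Summable (fun n : ℕ => 1 / ((n:ℝ)+1)^2) := by
    have := (summable_nat_add_iff 1).2 (Real.summable_one_div_nat_pow.2 (by norm_num : 1 < 2))
    simpa using this
  refine (h.mul_of_nonneg h (fun n => by positivity) (fun n => by positivity)).congr fun p => ?_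
  simp [FF]; ring
lemma F22_summable : Summable F22 := by
  refine Summable.of_nonneg_of_le (fun p => by unfold F22; positivity) (fun p => ?_) FF_summable
  unfold F22 FF
  have := (Nat.cast_nonneg p.1 : (0:ℝ) ≤ p.1)
  have h2 : (p.2:ℝ)+1 ≤ p.1+p.2+2 := by linarith
  gcongr
lemma F31_summable : Summable F31 := by
  refine Summable.of_nonneg_of_le (fun p => by unfold F31; positivity) (fun p => ?_) FF_summable
  unfold F31 FF
  have ha := (Nat.cast_nonneg p.1 : (0:ℝ) ≤ p.1)
  have hb := (Nat.cast_nonneg p.2 : (0:ℝ) ≤ p.2)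
  apply one_div_le_one_div_of_le (by positivity)
  have : ((p.1:ℝ)+1)*(p.2+1)^2 ≤ ((p.1:ℝ)+p.2+2) * (p.1+p.2+2)^2 := by
    gcongr ?_ * ?_^2 <;> linarith
  nlinarith

lemma swap_tsum (f : ℕ × ℕ → ℝ) : ∑' p : ℕ × ℕ, f p.swap = ∑' p, f p := (Equiv.prodComm ℕ ℕ).tsum_eq f
lemma swap_summable {f : ℕ × ℕ → ℝ} (h : Summable f) : Summable (fun p : ℕ × ℕ => f p.swap) :=
  (Equiv.prodComm ℕ ℕ).summable_iff.2 h

lemma shuffle : ∑' p, FF p = 2 * ∑' p, F22 p + 4 * ∑' p, F31 p := by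
  have e : ∀ p, FF p = (F22 p + F22 p.swap) + 2 * (F31 p + F31 p.swap) := by
    intro p
    simp only [FF, F22, F31, Prod.fst_swap, Prod.snd_swap]
    rw [add_comm (p.2:ℝ) (p.1:ℝ)]
    field_simp
    ring
  rw [tsum_congr e, Summable.tsum_add, Summable.tsum_add, tsum_mul_left, Summable.tsum_add,
    swap_tsum F22, swap_tsum F31]
  · ring
  · exact F31_summable
  · exact swap_summable F31_summable
  · exact F22_summable
  · exact swap_summable F22_summable
  · exact F22_summable.add (swap_summable F22_summable)
  · exact (F31_summable.add (swap_summable F31_summable)).mul_left 2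

lemma stuffle_lt : (∑' p : ℕ × ℕ, if p.1 < p.2 then FF p else 0) = ∑' p, F22 p := by
  have hi : Function.Injective (fun p : ℕ × ℕ => (p.1, p.1 + p.2 + 1)) := by
    rintro ⟨a, b⟩ ⟨c, d⟩ h; simp at h ⊢; omega
  rw [← hi.tsum_eq]
  · refine tsum_congr fun p => ?_
    rw [if_pos (by simp only; omega)]
    simp only [FF, F22]; push_cast; ring
  · rintro ⟨a, b⟩ h
    have : a < b := by by_contra h'; simp [h'] at h
    exact ⟨(a, b - a - 1), by simp; omega⟩

lemma stuffle : ∑' p, FF p = 2 * ∑' p, F22 p + ∑' n : ℕ, 1 / (n:ℝ)^4 := by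
  have hd : (∑' p : ℕ × ℕ, if p.1 = p.2 then FF p else 0) = ∑' n : ℕ, 1 / (n:ℝ)^4 := by
    have hi : Function.Injective (fun n : ℕ => (n, n)) := by
      intro a b h; simpa using h
    rw [← hi.tsum_eq]
    · rw [(Real.summable_one_div_nat_pow.2 (by norm_num : 1 < 4)).tsum_eq_zero_add]
      simp
      refine tsum_congr fun n => ?_
      simp only [FF]; field_simp
    · rintro ⟨a, b⟩ h
      have : a = b := by by_contra h'; simp [h'] at h
      exact ⟨a, by simp [this]⟩
  have hs : ∀ (q : ℕ × ℕ → Prop) [DecidablePred q], Summable (fun p => if q p then FF p else 0) := by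
    intro q _
    refine Summable.of_nonneg_of_le (fun p => ?_) (fun p => ?_) FF_summable
    · split_ifs
      · unfold FF; positivity
      · exact le_rfl
    · split_ifs
      · exact le_rfl
      · unfold FF; positivity
  have e : ∀ p : ℕ × ℕ, FF p = ((if p.1 < p.2 then FF p else 0) + (if p.2 < p.1 then FF p else 0))
      + (if p.1 = p.2 then FF p else 0) := by
    intro p
    rcases lt_trichotomy p.1 p.2 with h | h | h
    · simp [h, h.not_gt, h.ne]
    · simp [h]
    · simp [h, h.not_gt, h.ne']
  have hg : (∑' p : ℕ × ℕ, if p.2 < p.1 then FF p else 0) = ∑' p, F22 p := by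
    rw [← stuffle_lt, ← swap_tsum]
    refine tsum_congr fun p => ?_
    simp [FF, mul_comm]
  rw [tsum_congr e, Summable.tsum_add _ (hs _), Summable.tsum_add (hs _) (hs _), hd, hg, stuffle_lt]
  · ring
  · exact (hs _).add (hs _)

lemma F31_eq : ∑' p, F31 p = Sh 3 1 := by
  have hi : Function.Injective (fun p : ℕ × ℕ => (p.1 + p.2 + 2, p.1 + 1)) := by
    rintro ⟨a, b⟩ ⟨c, d⟩ h; simp at h ⊢; omega
  let G : ℕ × ℕ → ℝ := fun p => if 0 < p.2 ∧ p.2 < p.1 then (1 / (p.1:ℝ)^3) / (p.2:ℝ) else 0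
  have hG : ∀ p : ℕ × ℕ, G (p.1 + p.2 + 2, p.1 + 1) = F31 p := by
    intro p
    simp only [G]
    rw [if_pos (by omega)]
    simp only [F31]; push_cast; field_simp
  have hsup : ∀ p, p ∉ range (fun p : ℕ × ℕ => (p.1 + p.2 + 2, p.1 + 1)) → G p = 0 := by
    rintro ⟨a, b⟩ h
    by_contra h'
    have : 0 < b ∧ b < a := by by_contra h2; simp [G, h2] at h'
    exact h ⟨(b - 1, a - b - 1), by simp; omega⟩
  have hsum : Summable G := by
    rw [← hi.summable_iff hsup]
    exact F31_summable.congr fun p => (hG p).symm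
  have : ∑' p, F31 p = ∑' p, G p := by
    rw [← hi.tsum_eq (f := G)]
    · exact tsum_congr fun p => (hG p).symm
    · intro p hp; by_contra h; exact hp (hsup p h)
  rw [this, hsum.tsum_prod]
  unfold Sh PS
  refine tsum_congr fun n => ?_
  simp only [G]
  rw [inner_tsum_hh]; simp; ring

lemma Sh3_one : Sh 3 1 = (∑' n : ℕ, 1 / (n:ℝ)^4) / 4 := by
  have := shuffle; have := stuffle; rw [← F31_eq]; linarith

lemma dS3 {x : ℝ} (hx : |x| < 1) (h0 : x ≠ 0) : HasDerivAt (Sh 3) (Sh 2 x / x) x := Sh_deriv 2 hx h0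
lemma dS2 {x : ℝ} (hx : |x| < 1) (h0 : x ≠ 0) :
    HasDerivAt (Sh 2) (Real.log (1-x)^2 / 2 / x) x := by
  have := Sh_deriv 1 hx h0; rwa [Sh_one hx] at this
lemma dL3 {x : ℝ} (hx : |x| < 1) (h0 : x ≠ 0) : HasDerivAt (Li 3) (Li 2 x / x) x :=
  Li_deriv 2 (by norm_num) hx h0
lemma dL2 {x : ℝ} (hx : |x| < 1) (h0 : x ≠ 0) :
    HasDerivAt (Li 2) (-Real.log (1-x) / x) x := by
  have := Li_deriv 1 le_rfl hx h0; rwa [Li_one hx] at this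

lemma refl_right : Tendsto (fun x : ℝ => 1 - x) (𝓝[>] 0) (𝓝[<] 1) := by
  refine tendsto_nhdsWithin_iff.2 ⟨?_, ?_⟩
  · have : ContinuousAt (fun x : ℝ => 1 - x) 0 := by fun_prop
    simpa [ContinuousAt] using this.tendsto.mono_left nhdsWithin_le_nhds
  · filter_upwards [self_mem_nhdsWithin] with x hx
    simpa using hx
lemma refl_left : Tendsto (fun x : ℝ => 1 - x) (𝓝[<] 1) (𝓝[>] 0) := by
  refine tendsto_nhdsWithin_iff.2 ⟨?_, ?_⟩
  · have : ContinuousAt (fun x : ℝ => 1 - x) 1 := by fun_prop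
    simpa [ContinuousAt] using this.tendsto.mono_left nhdsWithin_le_nhds
  · filter_upwards [self_mem_nhdsWithin] with x hx
    simpa using hx

lemma lim_one {f : ℝ → ℝ} (hf : ContinuousOn f (Icc (-1) 1)) : Tendsto f (𝓝[<] 1) (𝓝 (f 1)) :=
  (hf 1 (by norm_num)).mono_left (nhdsWithin_le_of_mem (Icc_mem_nhdsLT (by norm_num)))
lemma lim_neg_one {f : ℝ → ℝ} (hf : ContinuousOn f (Icc (-1) 1)) : Tendsto f (𝓝[>] (-1)) (𝓝 (f (-1))) :=
  (hf (-1) (by norm_num)).mono_left (nhdsWithin_le_of_mem (Icc_mem_nhdsGT (by norm_num)))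
lemma lim_zero {f : ℝ → ℝ} (hf : ContinuousOn f (Icc (-1) 1)) : Tendsto f (𝓝 0) (𝓝 (f 0)) :=
  hf.continuousAt (Icc_mem_nhds (by norm_num) (by norm_num))

lemma log_lim_one : Tendsto Real.log (𝓝[<] 1) (𝓝 0) := by
  have := (Real.continuousAt_log one_ne_zero).tendsto.mono_left (nhdsWithin_le_nhds (s := Iio 1))
  simpa using this

lemma dlog1 : DifferentiableAt ℝ (fun x : ℝ => Real.log (1-x)) 0 :=
  DifferentiableAt.log (by fun_prop) (by norm_num)

/-- auxiliary `f` for reflection -/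
noncomputable def fR (x : ℝ) : ℝ := Sh 3 x - Real.log x * Sh 2 x

lemma fR_zero : Tendsto fR (𝓝[>] 0) (𝓝 0) := by
  have h1 := (lim_zero Sh3_cont).mono_left (nhdsWithin_le_nhds (s := Ioi 0))
  have h2 := log_pow_mul 1 (Sh_diff0 1) (Sh_z 2)
  have := h1.sub h2
  simp only [Sh_z, sub_zero, pow_one] at this
  exact this
lemma fR_one : Tendsto fR (𝓝[<] 1) (𝓝 (Sh 3 1)) := by
  have := (lim_one Sh3_cont).sub (log_lim_one.mul (lim_one Sh2_cont))
  rw [zero_mul, sub_zero] at this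
  exact this

lemma fR_deriv {x : ℝ} (hx : x ∈ Ioo (0:ℝ) 1) :
    HasDerivAt fR (- Real.log x * Real.log (1-x)^2 / 2 / x) x := by
  have hx' : |x| < 1 := abs_lt.2 ⟨by linarith [hx.1], hx.2⟩
  have h0 := hx.1.ne'
  refine ((dS3 hx' h0).sub ((Real.hasDerivAt_log h0).mul (dS2 hx' h0))).congr_deriv ?_
  field_simp; ring

lemma reflection : 2 * Sh 3 (1/2) + 2 * Real.log 2 * Sh 2 (1/2) + Real.log 2 ^ 4 / 4 = Sh 3 1 := by
  have hd : ∀ x ∈ Ioo (0:ℝ) 1, HasDerivAt (fun x => fR x + fR (1-x)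
      + (Real.log x ^ 2 * Real.log (1-x)^2) / 4) 0 x := by
    intro x hx
    have hx1 : 1 - x ∈ Ioo (0:ℝ) 1 := ⟨by linarith [hx.2], by linarith [hx.1]⟩
    have h0 := hx.1.ne'
    have h1 := hx1.1.ne'
    refine (((fR_deriv hx).add ((fR_deriv hx1).comp_const_sub 1 x)).add
      ((((Real.hasDerivAt_log h0).pow 2).mul
        (((Real.hasDerivAt_log h1).comp_const_sub 1 x).pow 2)).div_const 4)).congr_deriv ?_
    simp only [sub_sub_cancel, Pi.pow_apply]
    field_simp; ring
  have hl : Tendsto (fun x => fR x + fR (1-x)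
      + (Real.log x ^ 2 * Real.log (1-x)^2) / 4) (𝓝[>] 0) (𝓝 (Sh 3 1)) := by
    have := (fR_zero.add (fR_one.comp refl_right)).add
      ((log_pow_mul 2 (dlog1.pow 2) (by simp)).div_const 4)
    simpa using this
  have := const_left hd hl (x := 1/2) (by norm_num)
  have e : Real.log (1/2) = - Real.log 2 := by simp
  rw [show (1:ℝ) - 1/2 = 1/2 by norm_num, fR, e] at this
  linear_combination this

noncomputable def gR (u : ℝ) : ℝ :=
  Li 3 u - Real.log u * Li 2 u - (Real.log u ^ 2 * Real.log (1-u)) / 2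
lemma gR_zero : Tendsto gR (𝓝[>] 0) (𝓝 0) := by
  have h1 := (lim_zero (Li_cont 3 (by norm_num))).mono_left (nhdsWithin_le_nhds (s := Ioi 0))
  have h2 := log_pow_mul 1 (Li_diff0 1 le_rfl) (Li_z 2 (by norm_num))
  have h3 := (log_pow_mul 2 dlog1 (by simp)).div_const 2
  have := (h1.sub h2).sub h3
  rw [Li_z 3 (by norm_num)] at this
  simp only [sub_zero, pow_one, zero_div] at this
  exact this
lemma gR_one : Tendsto gR (𝓝[<] 1) (𝓝 (Li 3 1)) := by
  have h3 := ((log_pow_mul 1 (dlog1.pow 2) (by simp)).div_const 2).comp refl_left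
  have := ((lim_one (Li_cont 3 (by norm_num))).sub (log_lim_one.mul (lim_one (Li_cont 2 le_rfl)))).sub h3
  simp only [zero_mul, sub_zero, zero_div] at this
  refine this.congr fun x => ?_
  simp [gR]; ring
lemma gR_deriv {x : ℝ} (hx : x ∈ Ioo (0:ℝ) 1) :
    HasDerivAt gR (Real.log x ^ 2 / 2 / (1-x)) x := by
  have hx' : |x| < 1 := abs_lt.2 ⟨by linarith [hx.1], hx.2⟩
  have h0 := hx.1.ne'
  have h1 : 1 - x ≠ 0 := by linarith [hx.2]
  refine (((dL3 hx' h0).sub ((Real.hasDerivAt_log h0).mul (dL2 hx' h0))).sub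
    ((((Real.hasDerivAt_log h0).pow 2).mul
        ((Real.hasDerivAt_log h1).comp_const_sub 1 x)).div_const 2)).congr_deriv ?_
  simp only [Pi.pow_apply]
  field_simp; ring

lemma Sh2_one : Sh 2 1 = Li 3 1 := by
  have hd : ∀ x ∈ Ioo (0:ℝ) 1, HasDerivAt (fun x => Sh 2 x + gR (1-x)) 0 x := by
    intro x hx
    have hx' : |x| < 1 := abs_lt.2 ⟨by linarith [hx.1], hx.2⟩
    have hx1 : 1 - x ∈ Ioo (0:ℝ) 1 := ⟨by linarith [hx.2], by linarith [hx.1]⟩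
    refine ((dS2 hx' hx.1.ne').add ((gR_deriv hx1).comp_const_sub 1 x)).congr_deriv ?_
    simp only [sub_sub_cancel]
    ring
  have hl := ((lim_zero Sh2_cont).mono_left (nhdsWithin_le_nhds (s := Ioi 0))).add
    (gR_one.comp refl_right)
  have hr := (lim_one Sh2_cont).add (gR_zero.comp refl_left)
  have := const_both zero_lt_one hd hl hr
  rw [Sh_z] at this
  linarith

lemma landen : Sh 2 (-1) = Sh 2 (1/2) + Real.log 2 ^ 3 / 6 := by
  have hd : ∀ x ∈ Ioo (0:ℝ) (1/2), HasDerivAt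
      (fun x => Sh 2 (x/(x-1)) - Sh 2 x + Real.log (1-x) ^ 3 / 6) 0 x := by
    intro x hx
    have hx' : |x| < 1 := abs_lt.2 ⟨by linarith [hx.1], by linarith [hx.2]⟩
    have h0 := hx.1.ne'
    have hp : 0 < 1 - x := by linarith [hx.2]
    have h1 : 1 - x ≠ 0 := hp.ne'
    have h2 : x - 1 ≠ 0 := by linarith
    have hy : |x/(x-1)| < 1 := by
      rw [abs_div, abs_of_pos hx.1, abs_sub_comm, abs_of_pos hp, div_lt_one hp]; linarith [hx.2]
    have e : Real.log (1 - x/(x-1)) = - Real.log (1-x) := by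
      rw [← Real.log_inv]; congr 1; field_simp; ring
    have hq : HasDerivAt (fun x : ℝ => x/(x-1)) (-1/(x-1)^2) x := by
      refine ((hasDerivAt_id x).div ((hasDerivAt_id x).sub_const 1) h2).congr_deriv ?_
      simp
    have hS := dS2 hy (div_ne_zero h0 h2)
    rw [e] at hS
    refine (((hS.comp x hq).sub (dS2 hx' h0)).add
      ((((Real.hasDerivAt_log h1).comp_const_sub 1 x).pow 3).div_const 6)).congr_deriv ?_
    field_simp
    ring
  have hl : Tendsto (fun x => Sh 2 (x/(x-1)) - Sh 2 x + Real.log (1-x) ^ 3 / 6) (𝓝[>] 0) (𝓝 0) := by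
    have h1 : Tendsto (fun x : ℝ => x/(x-1)) (𝓝 0) (𝓝 0) := by
      have : ContinuousAt (fun x : ℝ => x/(x-1)) 0 :=
        ContinuousAt.div (by fun_prop) (by fun_prop) (by norm_num)
      simpa [ContinuousAt] using this
    have h2 := ((((lim_zero Sh2_cont).comp h1).sub (lim_zero Sh2_cont)).add
      ((dlog1.continuousAt.tendsto.pow 3).div_const 6)).mono_left (nhdsWithin_le_nhds (s := Ioi 0))
    simpa using h2
  have hr : Tendsto (fun x => Sh 2 (x/(x-1)) - Sh 2 x + Real.log (1-x) ^ 3 / 6) (𝓝[<] (1/2))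
      (𝓝 (Sh 2 (-1) - Sh 2 (1/2) + Real.log (1-1/2) ^ 3 / 6)) := by
    have hq : Tendsto (fun x : ℝ => x/(x-1)) (𝓝[<] (1/2)) (𝓝[>] (-1)) := by
      refine tendsto_nhdsWithin_iff.2 ⟨?_, ?_⟩
      · have : ContinuousAt (fun x : ℝ => x/(x-1)) (1/2) :=
          ContinuousAt.div (by fun_prop) (by fun_prop) (by norm_num)
        have h := this.tendsto.mono_left (nhdsWithin_le_nhds (s := Iio (1/2)))
        convert h using 2
        norm_num
      · filter_upwards [self_mem_nhdsWithin] with x hx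
        have hx : x < 1/2 := hx
        rw [mem_Ioi, lt_div_iff_of_neg (by linarith)]; linarith
    have h2 : ContinuousAt (fun x : ℝ => Real.log (1-x)) (1/2) :=
      ContinuousAt.log (by fun_prop) (by norm_num)
    have h3 : ContinuousAt (Sh 2) (1/2) :=
      Sh2_cont.continuousAt (Icc_mem_nhds (by norm_num) (by norm_num))
    exact (((lim_neg_one Sh2_cont).comp hq).sub (h3.tendsto.mono_left nhdsWithin_le_nhds)).add
      (((h2.tendsto.mono_left nhdsWithin_le_nhds).pow 3).div_const 6)
  have := const_both (by norm_num) hd hl hr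
  have e : Real.log (1-1/2) = - Real.log 2 := by
    rw [← Real.log_inv]; norm_num
  rw [e] at this
  linear_combination -this

/-- antiderivative of `2 log u ^ 2 / (1 - u ^ 2)` -/
noncomputable def RR (u : ℝ) : ℝ :=
  Real.log u ^ 2 * (Real.log (1+u) - Real.log (1-u)) - 2 * (Real.log u * (Li 2 u - Li 2 (-u)))
    + 2 * (Li 3 u - Li 3 (-u))

lemma RR_deriv {x : ℝ} (hx : x ∈ Ioo (0:ℝ) 1) :
    HasDerivAt RR (Real.log x ^ 2 * (1/(1+x) + 1/(1-x))) x := by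
  have hx' : |x| < 1 := abs_lt.2 ⟨by linarith [hx.1], hx.2⟩
  have hxn : |-x| < 1 := by rwa [abs_neg]
  have h0 := hx.1.ne'
  have hn0 : -x ≠ 0 := neg_ne_zero.2 h0
  have h1 : 1 - x ≠ 0 := by linarith [hx.2]
  have h2 : 1 + x ≠ 0 := by linarith [hx.1]
  have a1 : HasDerivAt (fun u => Li 2 (-u)) _ x := (dL2 hxn hn0).comp x (hasDerivAt_neg x)
  have a2 : HasDerivAt (fun u => Li 3 (-u)) _ x := (dL3 hxn hn0).comp x (hasDerivAt_neg x)
  have hL := Real.hasDerivAt_log h0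
  refine ((((hL.pow 2).mul
      (((Real.hasDerivAt_log h2).comp_const_add 1 x).sub ((Real.hasDerivAt_log h1).comp_const_sub 1 x))).sub
    ((hL.mul ((dL2 hx' h0).sub a1)).const_mul 2)).add
    (((dL3 hx' h0).sub a2).const_mul 2)).congr_deriv ?_
  simp only [Pi.pow_apply, Pi.sub_apply, sub_neg_eq_add]
  field_simp; ring

lemma dlog2 : DifferentiableAt ℝ (fun x : ℝ => Real.log (1+x)) 0 :=
  DifferentiableAt.log (by fun_prop) (by norm_num)

lemma neg_cont {f : ℝ → ℝ} (hf : ContinuousOn f (Icc (-1) 1)) :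
    ContinuousOn (fun x => f (-x)) (Icc (-1) 1) :=
  hf.comp (by fun_prop) (fun x hx => ⟨by linarith [hx.2], by linarith [hx.1]⟩)

lemma RR_zero : Tendsto RR (𝓝[>] 0) (𝓝 0) := by
  have c3 := Li_cont 3 (by norm_num)
  have h1 := (lim_zero (c3.sub (neg_cont c3))).mono_left (nhdsWithin_le_nhds (s := Ioi 0))
  have hd : DifferentiableAt ℝ (fun u => Li 2 u - Li 2 (-u)) 0 := by
    refine (Li_diff0 1 le_rfl).sub ?_
    refine DifferentiableAt.comp (g := Li 2) (0:ℝ) ?_ differentiableAt_id.neg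
    simpa using Li_diff0 1 le_rfl
  have h2 := log_pow_mul 1 hd (by simp)
  have h3 := log_pow_mul 2 (dlog2.sub dlog1) (by simp)
  have := (h3.sub (h2.const_mul 2)).add (h1.const_mul 2)
  simp only [Pi.sub_apply, pow_one, mul_zero, neg_zero, sub_self, add_zero] at this
  exact this
lemma RR_one : Tendsto RR (𝓝[<] 1) (𝓝 (2 * (Li 3 1 - Li 3 (-1)))) := by
  have c3 := Li_cont 3 (by norm_num)
  have c2 := Li_cont 2 (by norm_num)
  have h1 := lim_one (c3.sub (neg_cont c3))
  have h2 := log_lim_one.mul (lim_one (c2.sub (neg_cont c2)))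
  have h3 := (log_pow_mul 1 (dlog1.pow 2) (by simp)).comp refl_left
  have h4 : Tendsto (fun x : ℝ => Real.log (1+x)) (𝓝[<] 1) (𝓝 (Real.log (1+1))) := by
    have : ContinuousAt (fun x : ℝ => Real.log (1+x)) 1 :=
      ContinuousAt.log (by fun_prop) (by norm_num)
    exact this.tendsto.mono_left nhdsWithin_le_nhds
  have := ((((log_lim_one.pow 2).mul h4).sub h3).sub (h2.const_mul 2)).add (h1.const_mul 2)
  simp only [zero_mul, sub_zero, mul_zero, ne_eq, OfNat.ofNat_ne_zero, not_false_eq_true, zero_pow,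
    zero_add] at this
  refine this.congr fun x => ?_
  simp [RR]; ring

lemma Li3_neg : Li 3 1 + Li 3 (-1) = Li 3 1 / 4 := by
  have s1 : Summable (fun n : ℕ => 1 / (n:ℝ)^3) := Real.summable_one_div_nat_pow.2 (by norm_num)
  have s2 : Summable (fun n : ℕ => 1 / (n:ℝ)^3 * (-1)^n) := by
    refine Summable.of_norm_bounded s1 fun n => ?_
    simp
  have i2 : Function.Injective (fun k : ℕ => 2 * k) := fun a b h => by simpa using h
  have e : Li 3 1 + Li 3 (-1) = ∑' n : ℕ, (1 / (n:ℝ)^3 + 1 / (n:ℝ)^3 * (-1)^n) := by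
    rw [s1.tsum_add s2]; simp [Li, PS]
  rw [e]
  have hsup : Function.support (fun n : ℕ => 1 / (n:ℝ)^3 + 1 / (n:ℝ)^3 * (-1)^n) ⊆
      range (fun k : ℕ => 2 * k) := by
    intro n hn
    rcases Nat.even_or_odd n with h | h
    · obtain ⟨k, rfl⟩ := h
      exact ⟨k, by simp only; ring⟩
    · rw [Function.mem_support] at hn
      exact absurd (by rw [h.neg_one_pow]; ring) hn
  rw [← i2.tsum_eq hsup]
  unfold Li PS
  rw [← tsum_div_const]
  refine tsum_congr fun n => ?_
  rw [pow_mul]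
  push_cast
  norm_num
  ring

lemma Sh2_neg : Sh 2 (-1) = Li 3 1 / 8 := by
  have hd : ∀ x ∈ Ioo (0:ℝ) 1, HasDerivAt
      (fun x => Sh 2 (x^2) - 4 * Sh 2 x - 4 * Sh 2 (-x) - RR ((1-x)/(1+x))) 0 x := by
    intro x hx
    have hx' : |x| < 1 := abs_lt.2 ⟨by linarith [hx.1], by linarith [hx.2]⟩
    have hxn : |-x| < 1 := by rwa [abs_neg]
    have h0 := hx.1.ne'
    have hn0 : -x ≠ 0 := neg_ne_zero.2 h0
    have hp : 0 < 1 - x := by linarith [hx.2]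
    have hp2 : 0 < 1 + x := by linarith [hx.1]
    have h1 : 1 - x ≠ 0 := hp.ne'
    have h2 : 1 + x ≠ 0 := hp2.ne'
    have hsq : |x^2| < 1 := by rw [abs_pow]; exact pow_lt_one₀ (abs_nonneg _) hx' (by norm_num)
    have hu : (1-x)/(1+x) ∈ Ioo (0:ℝ) 1 := ⟨by positivity, by rw [div_lt_one hp2]; linarith [hx.1]⟩
    have hq : HasDerivAt (fun x : ℝ => (1-x)/(1+x)) (-2/(1+x)^2) x := by
      refine (((hasDerivAt_id x).const_sub 1).div ((hasDerivAt_id x).const_add 1) h2).congr_deriv ?_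
      simp; ring
    have hS1 : HasDerivAt (fun x => Sh 2 (x^2)) _ x :=
      HasDerivAt.comp (h := fun x : ℝ => x^2) x (dS2 hsq (pow_ne_zero 2 h0)) (hasDerivAt_pow 2 x)
    have hS2 := (dS2 hxn hn0).comp x (hasDerivAt_neg x)
    have hR := (RR_deriv hu).comp x hq
    have e1 : Real.log (1 - x^2) = Real.log (1-x) + Real.log (1+x) := by
      rw [← Real.log_mul h1 h2]; congr 1; ring
    rw [e1] at hS1
    rw [Real.log_div h1 h2] at hR
    have e2 : 1/(1+(1-x)/(1+x)) + 1/(1-(1-x)/(1+x)) = (1+x)/2 + (1+x)/(2*x) := by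
      have : 1+(1-x)/(1+x) = 2/(1+x) := by field_simp; ring
      have h' : 1-(1-x)/(1+x) = 2*x/(1+x) := by field_simp; ring
      rw [this, h']; simp
    rw [e2] at hR
    rw [sub_neg_eq_add] at hS2
    refine (((hS1.sub ((dS2 hx' h0).const_mul 4)).sub (hS2.const_mul 4)).sub hR).congr_deriv ?_
    field_simp
    ring
  have cq : ∀ a : ℝ, 0 ≤ a → ContinuousAt (fun x : ℝ => (1-x)/(1+x)) a := fun a ha =>
    ContinuousAt.div (by fun_prop) (by fun_prop) (by linarith)
  have hsqc : ContinuousOn (fun x => Sh 2 (x^2)) (Icc (-1) 1) :=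
    Sh2_cont.comp (by fun_prop) (fun x hx => ⟨by nlinarith, by nlinarith [hx.1, hx.2]⟩)
  have hC : ContinuousOn (fun x => Sh 2 (x^2) - 4 * Sh 2 x - 4 * Sh 2 (-x)) (Icc (-1) 1) :=
    (hsqc.sub (Sh2_cont.const_mul 4)).sub ((neg_cont Sh2_cont).const_mul 4)
  have q0 : Tendsto (fun x : ℝ => (1-x)/(1+x)) (𝓝[>] 0) (𝓝[<] 1) := by
    refine tendsto_nhdsWithin_iff.2 ⟨?_, ?_⟩
    · simpa using (cq 0 le_rfl).tendsto.mono_left (nhdsWithin_le_nhds (s := Ioi 0))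
    · filter_upwards [self_mem_nhdsWithin] with x hx
      have hx : 0 < x := hx
      rw [mem_Iio, div_lt_one (by linarith)]; linarith
  have q1 : Tendsto (fun x : ℝ => (1-x)/(1+x)) (𝓝[<] 1) (𝓝[>] 0) := by
    refine tendsto_nhdsWithin_iff.2 ⟨?_, ?_⟩
    · simpa using (cq 1 zero_le_one).tendsto.mono_left (nhdsWithin_le_nhds (s := Iio 1))
    · filter_upwards [Ioo_mem_nhdsLT (zero_lt_one (α := ℝ))] with x hx
      have h1 := hx.1
      have h2 := hx.2
      rw [mem_Ioi]
      exact div_pos (by linarith) (by linarith)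
  have hl := ((lim_zero hC).mono_left (nhdsWithin_le_nhds (s := Ioi 0))).sub (RR_one.comp q0)
  have hr := (lim_one hC).sub (RR_zero.comp q1)
  have := const_both zero_lt_one hd hl hr
  simp only [ne_eq, OfNat.ofNat_ne_zero, not_false_eq_true, zero_pow, neg_zero, Sh_z, one_pow,
    Sh2_one] at this
  have := Li3_neg
  linarith

theorem delta_3_1 :
    deltaD 3 1 = (∑' n : ℕ, 1 / (n : ℝ) ^ 4) / 8
      - (∑' n : ℕ, 1 / (n : ℝ) ^ 3) * Real.log 2 / 8 + (Real.log 2) ^ 4 / 24 := by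
  have e : (∑' n : ℕ, 1 / (n : ℝ) ^ 3) = Li 3 1 := by simp [Li, PS]
  have h1 := reflection
  have h2 := landen
  rw [Sh2_neg] at h2
  rw [Sh3_one] at h1
  rw [deltaD_eq, e]
  linear_combination h1 / 2 + Real.log 2 * h2
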